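/- arXiv:2006.08667 — 2 statements merged into one kernel-verified Lean document; each statement's English description precedes it below -/
import Mathlib

section
/- Let L : ℝⁿ × ℝᵐ → ℝ be twice continuously differentiable and ρ-weakly convex–weakly concave, and let η > max(ρ, 0). Then a point z ∈ ℝⁿ × ℝᵐ satisfies ∇L_η(z) = 0 if and only if ∇L(z) = 0; that is, the stationary points of the saddle envelope L_η are exactly the stationary points of L. -/
open Filter Topology Metric
open scoped RealInnerProductSpace

noncomputable section

abbrev Eu (n : ℕ) : Type := EuclideanSpace ℝ (Fin n)

noncomputable def gradx {n m : ℕ} (L : Eu n × Eu m → ℝ) (z : Eu n × Eu m) : Eu n :=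
  gradient (fun u => L (u, z.2)) z.1

noncomputable def grady {n m : ℕ} (L : Eu n × Eu m → ℝ) (z : Eu n × Eu m) : Eu m :=
  gradient (fun v => L (z.1, v)) z.2

noncomputable def Hxx {n m : ℕ} (L : Eu n × Eu m → ℝ) (z : Eu n × Eu m) : Eu n →L[ℝ] Eu n :=
  fderiv ℝ (fun x => gradient (fun u => L (u, z.2)) x) z.1

noncomputable def Hxy {n m : ℕ} (L : Eu n × Eu m → ℝ) (z : Eu n × Eu m) : Eu m →L[ℝ] Eu n :=
  fderiv ℝ (fun y => gradient (fun u => L (u, y)) z.1) z.2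

noncomputable def Hyx {n m : ℕ} (L : Eu n × Eu m → ℝ) (z : Eu n × Eu m) : Eu n →L[ℝ] Eu m :=
  fderiv ℝ (fun x => gradient (fun v => L (x, v)) z.2) z.1

noncomputable def Hyy {n m : ℕ} (L : Eu n × Eu m → ℝ) (z : Eu n × Eu m) : Eu m →L[ℝ] Eu m :=
  fderiv ℝ (fun y => gradient (fun v => L (z.1, v)) y) z.2

def WeaklyConvexConcave {n m : ℕ} (ρ : ℝ) (L : Eu n × Eu m → ℝ) : Prop :=
  ∀ z : Eu n × Eu m,
    (∀ v : Eu n, -ρ * ‖v‖ ^ 2 ≤ ⟪(Hxx L z) v, v⟫) ∧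
    (∀ w : Eu m, ⟪(Hyy L z) w, w⟫ ≤ ρ * ‖w‖ ^ 2)

def IntDomX {n m : ℕ} (η α : ℝ) (L : Eu n × Eu m → ℝ) : Prop :=
  ∀ z : Eu n × Eu m, ∀ v : Eu n,
    α * ‖v‖ ^ 2 ≤
      ⟪(Hxx L z) v +
        (Hxy L z) ((Ring.inverse (η • (1 : Eu m →L[ℝ] Eu m) - Hyy L z)) ((Hyx L z) v)), v⟫

def IntDomY {n m : ℕ} (η α : ℝ) (L : Eu n × Eu m → ℝ) : Prop :=
  ∀ z : Eu n × Eu m, ∀ w : Eu m,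
    α * ‖w‖ ^ 2 ≤
      ⟪-((Hyy L z) w) +
        (Hyx L z) ((Ring.inverse (η • (1 : Eu n →L[ℝ] Eu n) + Hxx L z)) ((Hxy L z) w)), w⟫

noncomputable def proxObj {n m : ℕ} (η : ℝ) (L : Eu n × Eu m → ℝ) (z w : Eu n × Eu m) : ℝ :=
  L w + η / 2 * ‖w.1 - z.1‖ ^ 2 - η / 2 * ‖w.2 - z.2‖ ^ 2

def IsProxPoint {n m : ℕ} (η : ℝ) (L : Eu n × Eu m → ℝ) (z w : Eu n × Eu m) : Prop :=
  (∀ v : Eu m, proxObj η L z (w.1, v) ≤ proxObj η L z w) ∧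
  (∀ u : Eu n, proxObj η L z w ≤ proxObj η L z (u, w.2))

noncomputable def saddleEnv {n m : ℕ} (η : ℝ) (L : Eu n × Eu m → ℝ)
    (prox : Eu n × Eu m → Eu n × Eu m) (z : Eu n × Eu m) : ℝ :=
  proxObj η L z (prox z)

noncomputable def moreau {n : ℕ} (η : ℝ) (f : Eu n → ℝ) (x : Eu n) : ℝ :=
  ⨅ u : Eu n, (f u + η / 2 * ‖u - x‖ ^ 2)

noncomputable def lyap {n m : ℕ} (η : ℝ) (L : Eu n × Eu m → ℝ) (z : Eu n × Eu m) : ℝ :=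
  -(moreau η (fun v => -L (z.1, v)) z.2) - moreau η (fun u => L (u, z.2)) z.1

noncomputable def hessForm {n m : ℕ} (L : Eu n × Eu m → ℝ) (z v w : Eu n × Eu m) : ℝ :=
  ⟪(Hxx L z) v.1, w.1⟫ + ⟪(Hxy L z) v.2, w.1⟫ + ⟪(Hyx L z) v.1, w.2⟫ + ⟪(Hyy L z) v.2, w.2⟫

section Gradient

variable {E : Type*} [NormedAddCommGroup E] [InnerProductSpace ℝ E] [CompleteSpace E]

lemma ContDiff.differentiable_gradient {f : E → ℝ} (hf : ContDiff ℝ 2 f) :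
    Differentiable ℝ (gradient f) := by
  have h : Differentiable ℝ (fderiv ℝ f) :=
    (hf.fderiv_right (m := 1) (by norm_num)).differentiable (by norm_num)
  exact (InnerProductSpace.toDual ℝ E).symm.toContinuousLinearEquiv.differentiable.comp h

lemma gradient_fun_neg (f : E → ℝ) : gradient (fun u => -f u) = fun u => -gradient f u := by
  ext1 u
  simp only [gradient, fderiv_fun_neg, map_neg]

/-- First-order lower bound for a function whose Hessian is bounded below by `-ρ`. -/
lemma add_inner_gradient_sub_le {f : E → ℝ} {ρ : ℝ} (hf : ContDiff ℝ 2 f)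
    (hess : ∀ x v, -ρ * ‖v‖ ^ 2 ≤ ⟪fderiv ℝ (gradient f) x v, v⟫) (x u : E) :
    f x + ⟪gradient f x, u - x⟫ - ρ / 2 * ‖u - x‖ ^ 2 ≤ f u := by
  set d := u - x with hd
  have hline (t : ℝ) : HasDerivAt (fun t : ℝ => x + t • d) d t := by
    simpa using ((hasDerivAt_id t).smul_const d).const_add x
  have h1 (t : ℝ) : HasDerivAt (fun t : ℝ => f (x + t • d) + ρ / 2 * ‖d‖ ^ 2 * t ^ 2)
      (⟪gradient f (x + t • d), d⟫ + ρ * ‖d‖ ^ 2 * t) t := by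
    have hg := ((hf.differentiable (by norm_num)) (x + t • d)).hasFDerivAt.comp_hasDerivAt t
      (hline t)
    rw [← inner_gradient_left] at hg
    have hq := ((hasDerivAt_id t).pow 2).const_mul (ρ / 2 * ‖d‖ ^ 2)
    refine (hg.add hq).congr_deriv ?_
    simp only [id, Nat.cast_ofNat]
    ring
  have h2 (t : ℝ) : HasDerivAt (fun t : ℝ => ⟪gradient f (x + t • d), d⟫ + ρ * ‖d‖ ^ 2 * t)
      (⟪fderiv ℝ (gradient f) (x + t • d) d, d⟫ + ρ * ‖d‖ ^ 2) t := by
    have hg := (hf.differentiable_gradient (x + t • d)).hasFDerivAt.comp_hasDerivAt t (hline t)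
    have hi := hg.inner ℝ (hasDerivAt_const t d)
    have hq := (hasDerivAt_id t).const_mul (ρ * ‖d‖ ^ 2)
    refine (hi.add hq).congr_deriv ?_
    simp
  have hderiv : deriv (fun t : ℝ => f (x + t • d) + ρ / 2 * ‖d‖ ^ 2 * t ^ 2) =
      fun t => ⟪gradient f (x + t • d), d⟫ + ρ * ‖d‖ ^ 2 * t := funext fun t => (h1 t).deriv
  have hmono : Monotone fun t : ℝ => ⟪gradient f (x + t • d), d⟫ + ρ * ‖d‖ ^ 2 * t := by
    refine monotone_of_deriv_nonneg (fun t => (h2 t).differentiableAt) fun t => ?_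
    rw [(h2 t).deriv]
    linarith [hess (x + t • d) d]
  have hconv := Monotone.convexOn_univ_of_deriv (fun t => (h1 t).differentiableAt)
    (hderiv ▸ hmono)
  have hslope := hconv.le_slope_of_hasDerivAt (Set.mem_univ 0) (Set.mem_univ 1) one_pos (h1 0)
  simp only [slope_def_field, zero_smul, one_smul, add_zero, hd, add_sub_cancel] at hslope
  rw [hd]
  linarith

/-- Fermat's rule for the proximal subproblem. -/
lemma gradient_eq_of_forall_prox_le {f : E → ℝ} {η : ℝ} {x u : E} (hf : DifferentiableAt ℝ f u)
    (hmin : ∀ w, f u + η / 2 * ‖u - x‖ ^ 2 ≤ f w + η / 2 * ‖w - x‖ ^ 2) :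
    gradient f u = η • (x - u) := by
  have hq := (((hasFDerivAt_id (𝕜 := ℝ) u).sub_const x).norm_sq).const_mul (η / 2)
  have h0 := IsLocalMin.hasFDerivAt_eq_zero (f := fun w => f w + η / 2 * ‖w - x‖ ^ 2)
    (Eventually.of_forall hmin) (hf.hasFDerivAt.add hq)
  refine ext_inner_right ℝ fun v => ?_
  have hv := DFunLike.congr_fun h0 v
  simp at hv
  rw [inner_gradient_left, real_inner_smul_left, ← neg_sub u x, inner_neg_left, inner_sub_left]
  linarith

/-- Quadratic growth of a strongly convex proximal subproblem around its minimizer. -/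
lemma prox_quadratic_growth {f : E → ℝ} {ρ η : ℝ} (hf : ContDiff ℝ 2 f)
    (hess : ∀ x v, -ρ * ‖v‖ ^ 2 ≤ ⟪fderiv ℝ (gradient f) x v, v⟫) {x u : E}
    (hmin : ∀ w, f u + η / 2 * ‖u - x‖ ^ 2 ≤ f w + η / 2 * ‖w - x‖ ^ 2) (w : E) :
    f u + η / 2 * ‖u - x‖ ^ 2 + (η - ρ) / 2 * ‖w - u‖ ^ 2 ≤ f w + η / 2 * ‖w - x‖ ^ 2 := by
  have h1 := add_inner_gradient_sub_le hf hess u w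
  rw [gradient_eq_of_forall_prox_le (hf.differentiable (by norm_num) u) hmin,
    real_inner_smul_left] at h1
  have h2 : ‖w - x‖ ^ 2 = ‖w - u‖ ^ 2 - 2 * ⟪x - u, w - u⟫ + ‖u - x‖ ^ 2 := by
    rw [show w - x = (w - u) - (x - u) by abel, norm_sub_sq_real, norm_sub_rev u x,
      real_inner_comm]
  rw [h2]
  linarith

/-- A stationary point of a weakly convex function minimizes its own proximal subproblem. -/
lemma le_add_of_gradient_eq_zero {f : E → ℝ} {ρ η : ℝ} (hf : ContDiff ℝ 2 f)
    (hess : ∀ x v, -ρ * ‖v‖ ^ 2 ≤ ⟪fderiv ℝ (gradient f) x v, v⟫) (hη : ρ ≤ η) {x : E}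
    (hx : gradient f x = 0) (w : E) : f x ≤ f w + η / 2 * ‖w - x‖ ^ 2 := by
  have h1 := add_inner_gradient_sub_le hf hess x w
  rw [hx, inner_zero_left] at h1
  nlinarith [sq_nonneg ‖w - x‖]

/-- Danskin-type formula: a parametrized saddle value, regularized quadratically in its
minimizing variable, has gradient `η • (x - p x)`, where `p x` is the minimizing component. -/
lemma hasGradientAt_saddle_value {F : Type*} {N : E → F → ℝ} {p : E → E} {q : E → F} {η μ : ℝ}
    (hη : 0 ≤ η) (hμ : 0 < μ)
    (hmax : ∀ x v, N (p x) v ≤ N (p x) (q x))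
    (hmin : ∀ x u, N (p x) (q x) + η / 2 * ‖p x - x‖ ^ 2 + μ / 2 * ‖u - p x‖ ^ 2 ≤
      N u (q x) + η / 2 * ‖u - x‖ ^ 2) (x : E) :
    HasGradientAt (fun x => N (p x) (q x) + η / 2 * ‖p x - x‖ ^ 2) (η • (x - p x)) x := by
  have hsq (a b c : E) : ‖c - b‖ ^ 2 = ‖c - a‖ ^ 2 + 2 * ⟪a - c, b - a⟫ + ‖b - a‖ ^ 2 := by
    rw [norm_sub_rev c b, norm_sub_rev c a, ← norm_add_sq_real, sub_add_sub_comm,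
      add_comm a b, add_sub_add_comm]
    simp
  have hlip (a b : E) : μ * ‖p b - p a‖ ≤ η * ‖b - a‖ := by
    have h1 := hmin a (p b)
    have h2 := hmin b (p a)
    have h3 := hmax b (q a)
    have h4 := hmax a (q b)
    have h5 := hsq a b (p a)
    have h6 := hsq a b (p b)
    have h7 : ⟪a - p a, b - a⟫ - ⟪a - p b, b - a⟫ = ⟪p b - p a, b - a⟫ := by
      rw [← inner_sub_left, sub_sub_sub_cancel_left]
    have h8 := mul_le_mul_of_nonneg_left (real_inner_le_norm (p b - p a) (b - a)) hη
    rw [norm_sub_rev (p a) (p b)] at h2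
    rcases (norm_nonneg (p b - p a)).eq_or_lt with h0 | h0
    · rw [← h0, mul_zero]
      positivity
    · have h9 : μ * ‖p b - p a‖ ^ 2 ≤ η * ⟪p b - p a, b - a⟫ := by
        rw [h5] at h2
        rw [h6] at h2
        rw [← h7]
        nlinarith
      refine le_of_mul_le_mul_right ?_ h0
      linarith
  have hub (a b : E) : N (p b) (q b) + η / 2 * ‖p b - b‖ ^ 2 ≤
      N (p a) (q a) + η / 2 * ‖p a - a‖ ^ 2 + η * ⟪a - p a, b - a⟫ + η / 2 * ‖b - a‖ ^ 2 := by
    have h1 := hmin b (p a)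
    have h2 := hmax a (q b)
    rw [hsq a b (p a)] at h1
    have h3 : 0 ≤ μ / 2 * ‖p a - p b‖ ^ 2 := by positivity
    linarith
  rw [hasGradientAt_iff_isLittleO]
  refine Asymptotics.IsBigO.trans_isLittleO (g := fun b => ‖b - x‖ ^ 2) ?_ ?_
  · refine Asymptotics.IsBigO.of_bound (η / 2 + η * (η / μ)) (Eventually.of_forall fun b => ?_)
    have h1 := hub x b
    have h2 := hub b x
    rw [norm_sub_rev x b, ← neg_sub b x, inner_neg_right] at h2
    have h3 : ⟪b - p b, b - x⟫ = ⟪x - p x, b - x⟫ + ‖b - x‖ ^ 2 - ⟪p b - p x, b - x⟫ := by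
      rw [← real_inner_self_eq_norm_sq, ← inner_add_left, ← inner_sub_left]
      congr 1
      abel
    have h4 := real_inner_le_norm (p b - p x) (b - x)
    have h5 : ‖p b - p x‖ ≤ η / μ * ‖b - x‖ := by
      rw [div_mul_eq_mul_div, le_div_iff₀ hμ]
      linarith [hlip x b]
    have h6 : η * ⟪p b - p x, b - x⟫ ≤ η * (η / μ) * ‖b - x‖ ^ 2 := by
      have := mul_le_mul_of_nonneg_right h5 (norm_nonneg (b - x))
      calc η * ⟪p b - p x, b - x⟫ ≤ η * (η / μ * ‖b - x‖ * ‖b - x‖) :=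
            mul_le_mul_of_nonneg_left (h4.trans this) hη
        _ = _ := by ring
    have h7 : 0 ≤ η * (η / μ) * ‖b - x‖ ^ 2 := by positivity
    have h8 : 0 ≤ η * ‖b - x‖ ^ 2 := by positivity
    rw [h3] at h2
    rw [real_inner_smul_left, Real.norm_eq_abs, norm_pow, norm_norm, abs_le]
    constructor <;> linarith
  · have h : Tendsto (fun b => b - x) (𝓝 x) (𝓝 0) := by
      simpa using (continuous_id.sub continuous_const).tendsto (x := x) (f := fun b : E => b - x)
    exact (Asymptotics.isLittleO_norm_pow_id one_lt_two).comp_tendsto h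

end Gradient

section SaddleEnvelope

variable {n m : ℕ} {L : Eu n × Eu m → ℝ} {ρ η : ℝ}

lemma contDiff_left_slice (hL : ContDiff ℝ 2 L) (y : Eu m) : ContDiff ℝ 2 fun u => L (u, y) :=
  hL.comp (contDiff_id.prodMk contDiff_const)

lemma contDiff_neg_right_slice (hL : ContDiff ℝ 2 L) (x : Eu n) :
    ContDiff ℝ 2 fun v => -L (x, v) :=
  (hL.comp (contDiff_const.prodMk contDiff_id)).neg

lemma WeaklyConvexConcave.hessian_left (h : WeaklyConvexConcave ρ L) (y : Eu m) (x v : Eu n) :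
    -ρ * ‖v‖ ^ 2 ≤ ⟪fderiv ℝ (gradient fun u => L (u, y)) x v, v⟫ :=
  (h (x, y)).1 v

lemma WeaklyConvexConcave.hessian_neg_right (h : WeaklyConvexConcave ρ L) (x : Eu n)
    (y w : Eu m) : -ρ * ‖w‖ ^ 2 ≤ ⟪fderiv ℝ (gradient fun v => -L (x, v)) y w, w⟫ := by
  have := (h (x, y)).2 w
  simp only [Hyy] at this
  rw [gradient_fun_neg, fderiv_fun_neg, neg_apply, inner_neg_left]
  linarith

lemma IsProxPoint.left_min {z w : Eu n × Eu m} (h : IsProxPoint η L z w) (u : Eu n) :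
    L w + η / 2 * ‖w.1 - z.1‖ ^ 2 ≤ L (u, w.2) + η / 2 * ‖u - z.1‖ ^ 2 := by
  have := h.2 u
  simp only [proxObj] at this
  linarith

lemma IsProxPoint.right_min {z w : Eu n × Eu m} (h : IsProxPoint η L z w) (v : Eu m) :
    -L w + η / 2 * ‖w.2 - z.2‖ ^ 2 ≤ -L (w.1, v) + η / 2 * ‖v - z.2‖ ^ 2 := by
  have := h.1 v
  simp only [proxObj] at this
  linarith

lemma gradx_saddleEnv (hL : ContDiff ℝ 2 L) (hweak : WeaklyConvexConcave ρ L) (hρ : ρ < η)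
    (hη : 0 ≤ η) {prox : Eu n × Eu m → Eu n × Eu m} (hprox : ∀ z, IsProxPoint η L z (prox z))
    (z : Eu n × Eu m) : gradx (saddleEnv η L prox) z = η • (z.1 - (prox z).1) := by
  have key := hasGradientAt_saddle_value
    (N := fun u v => L (u, v) - η / 2 * ‖v - z.2‖ ^ 2)
    (p := fun x => (prox (x, z.2)).1) (q := fun x => (prox (x, z.2)).2) hη (sub_pos.2 hρ)
    (fun x v => by
      have := (hprox (x, z.2)).right_min v
      dsimp only at this ⊢
      linarith)
    (fun x u => by
      have := prox_quadratic_growth (contDiff_left_slice hL (prox (x, z.2)).2)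
        (hweak.hessian_left _) (hprox (x, z.2)).left_min u
      dsimp only at this ⊢
      linarith) z.1
  rw [← key.gradient]
  unfold gradx
  congr 1
  ext x
  simp only [saddleEnv, proxObj]
  ring

lemma grady_saddleEnv (hL : ContDiff ℝ 2 L) (hweak : WeaklyConvexConcave ρ L) (hρ : ρ < η)
    (hη : 0 ≤ η) {prox : Eu n × Eu m → Eu n × Eu m} (hprox : ∀ z, IsProxPoint η L z (prox z))
    (z : Eu n × Eu m) : grady (saddleEnv η L prox) z = -(η • (z.2 - (prox z).2)) := by
  have key := hasGradientAt_saddle_value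
    (N := fun v u => -L (u, v) - η / 2 * ‖u - z.1‖ ^ 2)
    (p := fun y => (prox (z.1, y)).2) (q := fun y => (prox (z.1, y)).1) hη (sub_pos.2 hρ)
    (fun y u => by
      have := (hprox (z.1, y)).left_min u
      dsimp only at this ⊢
      linarith)
    (fun y v => by
      have := prox_quadratic_growth (contDiff_neg_right_slice hL (prox (z.1, y)).1)
        (hweak.hessian_neg_right _) (hprox (z.1, y)).right_min v
      dsimp only at this ⊢
      linarith) z.2
  rw [← key.gradient, ← congrFun (gradient_fun_neg _) z.2]
  unfold grady
  congr 1
  ext y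
  simp only [saddleEnv, proxObj]
  ring

lemma IsProxPoint.gradx_eq_zero (hL : ContDiff ℝ 2 L) {z : Eu n × Eu m}
    (h : IsProxPoint η L z z) : gradx L z = 0 := by
  have := gradient_eq_of_forall_prox_le
    ((contDiff_left_slice hL z.2).differentiable (by norm_num) z.1) h.left_min
  simpa [gradx] using this

lemma IsProxPoint.grady_eq_zero (hL : ContDiff ℝ 2 L) {z : Eu n × Eu m}
    (h : IsProxPoint η L z z) : grady L z = 0 := by
  have := gradient_eq_of_forall_prox_le
    ((contDiff_neg_right_slice hL z.1).differentiable (by norm_num) z.2) h.right_min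
  rw [gradient_fun_neg] at this
  simpa [grady] using this

lemma isProxPoint_self (hL : ContDiff ℝ 2 L) (hweak : WeaklyConvexConcave ρ L) (hρ : ρ ≤ η)
    {z : Eu n × Eu m} (hx : gradx L z = 0) (hy : grady L z = 0) : IsProxPoint η L z z := by
  constructor
  · intro v
    have hy' : gradient (fun v => -L (z.1, v)) z.2 = 0 := by
      rw [gradient_fun_neg]
      exact neg_eq_zero.2 hy
    have := le_add_of_gradient_eq_zero (contDiff_neg_right_slice hL z.1)
      (hweak.hessian_neg_right z.1) hρ hy' v
    simp only [proxObj, sub_self, norm_zero, Prod.mk.eta] at this ⊢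
    linarith
  · intro u
    have := le_add_of_gradient_eq_zero (contDiff_left_slice hL z.2)
      (hweak.hessian_left z.2) hρ hx u
    simp only [proxObj, sub_self, norm_zero, Prod.mk.eta] at this ⊢
    linarith

end SaddleEnvelope

/-- the stationary points of the saddle envelope are exactly the
stationary points of the original objective. -/
theorem statement4 {n m : ℕ}
    (L : Eu n × Eu m → ℝ) (ρ η : ℝ)
    (hL : ContDiff ℝ 2 L)
    (hweak : WeaklyConvexConcave ρ L)
    (hη : max ρ 0 < η)
    (prox : Eu n × Eu m → Eu n × Eu m)
    (hprox : ∀ z, IsProxPoint η L z (prox z))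
    (hprox_uniq : ∀ z w, IsProxPoint η L z w → w = prox z) :
    ∀ z : Eu n × Eu m,
      (gradx (saddleEnv η L prox) z = 0 ∧ grady (saddleEnv η L prox) z = 0) ↔
        (gradx L z = 0 ∧ grady L z = 0) := by
  intro z
  have hρ : ρ < η := (le_max_left ρ 0).trans_lt hη
  have hη0 : 0 < η := (le_max_right ρ 0).trans_lt hη
  rw [gradx_saddleEnv hL hweak hρ hη0.le hprox, grady_saddleEnv hL hweak hρ hη0.le hprox,
    neg_eq_zero, smul_eq_zero_iff_right hη0.ne', smul_eq_zero_iff_right hη0.ne', sub_eq_zero,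
    sub_eq_zero]
  constructor
  · rintro ⟨hx, hy⟩
    have h := hprox z
    rw [← Prod.ext hx hy] at h
    exact ⟨h.gradx_eq_zero hL, h.grady_eq_zero hL⟩
  · rintro ⟨hx, hy⟩
    have h := hprox_uniq z z (isProxPoint_self hL hweak hρ.le hx hy)
    exact ⟨congrArg Prod.fst h, congrArg Prod.snd h⟩

end
end

section
/- Let L : ℝⁿ × ℝᵐ → ℝ be twice continuously differentiable and ρ-weakly convex–weakly concave, and let η > max(ρ, 0). If L is α-interaction dominant with respect to x for some α ∈ ℝ (with necessarily η + α > 0), then for every z, (ηα/(η+α)) I ⪯ ∇²_{xx}L_η(z) ⪯ ηI; and if L is α-interaction dominant with respect to y, then for every z, (ηα/(η+α)) I ⪯ −∇²_{yy}L_η(z) ⪯ ηI. In particular, interaction dominance with α > 0 in x (respectively y) makes the saddle envelope ηα/(η+α)-strongly convex in x (respectively strongly concave in y). -/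
open Filter Topology Metric
open scoped RealInnerProductSpace

noncomputable section

lemma hessian_bounds_of_resolvent {E : Type*} [NormedAddCommGroup E] [InnerProductSpace ℝ E]
    {η α : ℝ} (hη : 0 < η) (hηα : 0 < η + α) {a v q : E}
    (h : η • a + q = η • v) (hq : α * ‖a‖ ^ 2 ≤ ⟪q, a⟫) :
    η * α / (η + α) * ‖v‖ ^ 2 ≤ ⟪η • (v - a), v⟫ ∧ ⟪η • (v - a), v⟫ ≤ η * ‖v‖ ^ 2 := by
  have hinner : η * ‖a‖ ^ 2 + ⟪q, a⟫ = η * ⟪a, v⟫ := by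
    have h' := congrArg (fun t => ⟪t, a⟫) h
    simp only [inner_add_left, real_inner_smul_left, real_inner_self_eq_norm_sq] at h'
    rw [h', real_inner_comm]
  have hsq : 0 ≤ (η + α) ^ 2 * ‖a‖ ^ 2 - 2 * (η * (η + α)) * ⟪a, v⟫ + η ^ 2 * ‖v‖ ^ 2 := by
    have h' := sq_nonneg ‖(η + α) • a - η • v‖
    rw [norm_sub_sq_real, norm_smul, norm_smul, mul_pow, mul_pow, Real.norm_eq_abs,
      Real.norm_eq_abs, sq_abs, sq_abs, real_inner_smul_left, real_inner_smul_right] at h'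
    linarith
  have ha : (η + α) * ‖a‖ ^ 2 ≤ η * ⟪a, v⟫ := by linarith
  have hpos : 0 ≤ η * ⟪a, v⟫ := le_trans (by positivity) ha
  have hkey : (η + α) * ⟪a, v⟫ ≤ η * ‖v‖ ^ 2 := by
    have h1 := mul_le_mul_of_nonneg_left ha hηα.le
    refine le_of_mul_le_mul_left ?_ hη
    linarith
  rw [real_inner_smul_left, inner_sub_left, real_inner_self_eq_norm_sq]
  refine ⟨?_, by linarith⟩
  rw [div_mul_eq_mul_div, div_le_iff₀ hηα]
  have h2 := mul_le_mul_of_nonneg_left hkey hη.le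
  linarith

lemma eq_ringInverse_apply_of_coercive {E : Type*} [NormedAddCommGroup E] [InnerProductSpace ℝ E]
    [FiniteDimensional ℝ E] {c : ℝ} (hc : 0 < c) {A : E →L[ℝ] E}
    (hA : ∀ w, c * ‖w‖ ^ 2 ≤ ⟪A w, w⟫) {b y : E} (h : A b = y) :
    b = Ring.inverse A y := by
  have hinj : Function.Injective A := by
    refine (injective_iff_map_eq_zero A).2 fun w hw => ?_
    have h' := hA w
    rw [hw, inner_zero_left] at h'
    have : ‖w‖ ^ 2 = 0 := le_antisymm (by nlinarith) (sq_nonneg _)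
    simpa using this
  have hunit : IsUnit A := by
    let e : E ≃L[ℝ] E :=
      (LinearEquiv.ofInjectiveEndo (A : E →ₗ[ℝ] E) hinj).toContinuousLinearEquiv
    refine ⟨ContinuousLinearEquiv.toUnit e, ?_⟩
    ext w
    rfl
  have h' := congrArg (fun B : E →L[ℝ] E => B b) (Ring.inverse_mul_cancel A hunit)
  simpa [h] using h'.symm

section Partial

variable {n m : ℕ} {L : Eu n × Eu m → ℝ}

lemma inner_gradx {z : Eu n × Eu m} (hL : DifferentiableAt ℝ L z) (a : Eu n) :
    ⟪gradx L z, a⟫ = fderiv ℝ L z (a, 0) := by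
  have h : HasFDerivAt (fun u => L (u, z.2)) _ z.1 :=
    HasFDerivAt.comp (g := L) z.1 hL.hasFDerivAt (hasFDerivAt_prodMk_left z.1 z.2)
  rw [gradx, gradient, InnerProductSpace.toDual_symm_apply, h.fderiv]
  rfl

lemma inner_grady {z : Eu n × Eu m} (hL : DifferentiableAt ℝ L z) (b : Eu m) :
    ⟪grady L z, b⟫ = fderiv ℝ L z (0, b) := by
  have h : HasFDerivAt (fun v => L (z.1, v)) _ z.2 :=
    HasFDerivAt.comp (g := L) z.2 hL.hasFDerivAt (hasFDerivAt_prodMk_right z.1 z.2)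
  rw [grady, gradient, InnerProductSpace.toDual_symm_apply, h.fderiv]
  rfl

lemma fderiv_apply_eq_inner {z : Eu n × Eu m} (hL : DifferentiableAt ℝ L z)
    (w : Eu n × Eu m) : fderiv ℝ L z w = ⟪gradx L z, w.1⟫ + ⟪grady L z, w.2⟫ := by
  rw [inner_gradx hL, inner_grady hL, ← map_add]
  simp

lemma differentiable_gradx (hL : ContDiff ℝ 2 L) : Differentiable ℝ (gradx L) := by
  have hd : Differentiable ℝ L := hL.differentiable (by norm_num)
  have h1 : Differentiable ℝ (fderiv ℝ L) :=
    (hL.fderiv_right (m := 1) (by norm_num)).differentiable (by norm_num)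
  have heq : gradx L = fun z => (InnerProductSpace.toDual ℝ (Eu n)).symm
      ((fderiv ℝ L z).comp (ContinuousLinearMap.inl ℝ (Eu n) (Eu m))) := by
    funext z
    refine ext_inner_right ℝ fun a => ?_
    rw [inner_gradx (hd z), InnerProductSpace.toDual_symm_apply]
    rfl
  rw [heq]
  exact (InnerProductSpace.toDual ℝ (Eu n)).symm.toContinuousLinearEquiv.differentiable.comp
    (h1.clm_comp (differentiable_const _))

lemma differentiable_grady (hL : ContDiff ℝ 2 L) : Differentiable ℝ (grady L) := by
  have hd : Differentiable ℝ L := hL.differentiable (by norm_num)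
  have h1 : Differentiable ℝ (fderiv ℝ L) :=
    (hL.fderiv_right (m := 1) (by norm_num)).differentiable (by norm_num)
  have heq : grady L = fun z => (InnerProductSpace.toDual ℝ (Eu m)).symm
      ((fderiv ℝ L z).comp (ContinuousLinearMap.inr ℝ (Eu n) (Eu m))) := by
    funext z
    refine ext_inner_right ℝ fun b => ?_
    rw [inner_grady (hd z), InnerProductSpace.toDual_symm_apply]
    rfl
  rw [heq]
  exact (InnerProductSpace.toDual ℝ (Eu m)).symm.toContinuousLinearEquiv.differentiable.comp
    (h1.clm_comp (differentiable_const _))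

lemma hasFDerivAt_gradx (hL : ContDiff ℝ 2 L) (z : Eu n × Eu m) :
    HasFDerivAt (gradx L) ((Hxx L z).coprod (Hxy L z)) z := by
  have h := (differentiable_gradx hL z).hasFDerivAt
  have hx : HasFDerivAt (fun x => gradient (fun u => L (u, z.2)) x) _ z.1 :=
    HasFDerivAt.comp (g := gradx L) (f := fun x => (x, z.2)) z.1 h (hasFDerivAt_prodMk_left z.1 z.2)
  have hy : HasFDerivAt (fun y => gradient (fun u => L (u, y)) z.1) _ z.2 :=
    HasFDerivAt.comp (g := gradx L) (f := fun y => (z.1, y)) z.2 h (hasFDerivAt_prodMk_right z.1 z.2)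
  rw [Hxx, Hxy, hx.fderiv, hy.fderiv]
  convert h using 1
  exact ContinuousLinearMap.coprod_comp_inl_inr _

lemma hasFDerivAt_grady (hL : ContDiff ℝ 2 L) (z : Eu n × Eu m) :
    HasFDerivAt (grady L) ((Hyx L z).coprod (Hyy L z)) z := by
  have h := (differentiable_grady hL z).hasFDerivAt
  have hx : HasFDerivAt (fun x => gradient (fun v => L (x, v)) z.2) _ z.1 :=
    HasFDerivAt.comp (g := grady L) (f := fun x => (x, z.2)) z.1 h (hasFDerivAt_prodMk_left z.1 z.2)
  have hy : HasFDerivAt (fun y => gradient (fun v => L (z.1, v)) y) _ z.2 :=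
    HasFDerivAt.comp (g := grady L) (f := fun y => (z.1, y)) z.2 h (hasFDerivAt_prodMk_right z.1 z.2)
  rw [Hyx, Hyy, hx.fderiv, hy.fderiv]
  convert h using 1
  exact ContinuousLinearMap.coprod_comp_inl_inr _

lemma inner_Hxy_eq_inner_Hyx (hL : ContDiff ℝ 2 L) (z : Eu n × Eu m) (a : Eu n) (b : Eu m) :
    ⟪Hxy L z b, a⟫ = ⟪Hyx L z a, b⟫ := by
  have hd : Differentiable ℝ L := hL.differentiable (by norm_num)
  have h1 : Differentiable ℝ (fderiv ℝ L) :=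
    (hL.fderiv_right (m := 1) (by norm_num)).differentiable (by norm_num)
  have hx : fderiv ℝ (fderiv ℝ L) z (0, b) (a, 0) = ⟪Hxy L z b, a⟫ := by
    have e : (fun w => fderiv ℝ L w (a, 0)) = fun w => ⟪gradx L w, a⟫ :=
      funext fun w => (inner_gradx (hd w) a).symm
    have d1 := (h1 z).hasFDerivAt.clm_apply (hasFDerivAt_const ((a, 0) : Eu n × Eu m) z)
    have d2 := (hasFDerivAt_gradx hL z).inner ℝ (hasFDerivAt_const a z)
    rw [e] at d1
    have h := congrArg (fun T => T ((0, b) : Eu n × Eu m)) (d1.unique d2)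
    simpa using h
  have hy : fderiv ℝ (fderiv ℝ L) z (a, 0) (0, b) = ⟪Hyx L z a, b⟫ := by
    have e : (fun w => fderiv ℝ L w (0, b)) = fun w => ⟪grady L w, b⟫ :=
      funext fun w => (inner_grady (hd w) b).symm
    have d1 := (h1 z).hasFDerivAt.clm_apply (hasFDerivAt_const ((0, b) : Eu n × Eu m) z)
    have d2 := (hasFDerivAt_grady hL z).inner ℝ (hasFDerivAt_const b z)
    rw [e] at d1
    have h := congrArg (fun T => T ((a, 0) : Eu n × Eu m)) (d1.unique d2)
    simpa using h
  rw [← hx, ← hy]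
  exact (hL.contDiffAt.isSymmSndFDerivAt (by simp)).eq _ _

/-- The operator `w ↦ w + η⁻¹ (∇ₓL(w), -∇ᵧL(w))`, of which the proximal operator is the inverse. -/
def proxInv (η : ℝ) (L : Eu n × Eu m → ℝ) (w : Eu n × Eu m) : Eu n × Eu m :=
  (w.1 + η⁻¹ • gradx L w, w.2 - η⁻¹ • grady L w)

/-- The derivative of `proxInv`. -/
def proxInvDeriv (η : ℝ) (L : Eu n × Eu m → ℝ) (w : Eu n × Eu m) :
    Eu n × Eu m →L[ℝ] Eu n × Eu m :=
  (ContinuousLinearMap.fst ℝ _ _ + η⁻¹ • (Hxx L w).coprod (Hxy L w)).prod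
    (ContinuousLinearMap.snd ℝ _ _ - η⁻¹ • (Hyx L w).coprod (Hyy L w))

lemma hasFDerivAt_proxInv (hL : ContDiff ℝ 2 L) (η : ℝ) (w : Eu n × Eu m) :
    HasFDerivAt (proxInv η L) (proxInvDeriv η L w) w :=
  (hasFDerivAt_fst.add ((hasFDerivAt_gradx hL w).const_smul η⁻¹)).prodMk
    (hasFDerivAt_snd.sub ((hasFDerivAt_grady hL w).const_smul η⁻¹))

lemma proxInvDeriv_coercive (hL : ContDiff ℝ 2 L) {ρ η : ℝ} (hη : 0 < η)
    (hweak : WeaklyConvexConcave ρ L) (w d : Eu n × Eu m) :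
    (1 - ρ / η) * (‖d.1‖ ^ 2 + ‖d.2‖ ^ 2) ≤
      ⟪(proxInvDeriv η L w d).1, d.1⟫ + ⟪(proxInvDeriv η L w d).2, d.2⟫ := by
  have hx := mul_le_mul_of_nonneg_left ((hweak w).1 d.1) (inv_pos.2 hη).le
  have hy := mul_le_mul_of_nonneg_left ((hweak w).2 d.2) (inv_pos.2 hη).le
  have hs := inner_Hxy_eq_inner_Hyx hL w d.1 d.2
  simp only [proxInvDeriv, ContinuousLinearMap.prod_apply, add_apply,
    sub_apply, smul_apply,
    ContinuousLinearMap.coprod_apply, ContinuousLinearMap.coe_fst', ContinuousLinearMap.coe_snd',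
    inner_add_left, inner_sub_left, real_inner_smul_left, real_inner_self_eq_norm_sq, hs]
  rw [div_eq_inv_mul]
  linarith

lemma proxInv_strongly_monotone (hL : ContDiff ℝ 2 L) {ρ η : ℝ} (hη : 0 < η)
    (hweak : WeaklyConvexConcave ρ L) (p q : Eu n × Eu m) :
    (1 - ρ / η) * (‖(p - q).1‖ ^ 2 + ‖(p - q).2‖ ^ 2) ≤
      ⟪(proxInv η L p - proxInv η L q).1, (p - q).1⟫ +
        ⟪(proxInv η L p - proxInv η L q).2, (p - q).2⟫ := by
  set d := p - q with hd
  let φ : ℝ → ℝ := fun t =>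
    ⟪(proxInv η L (q + t • d)).1, d.1⟫ + ⟪(proxInv η L (q + t • d)).2, d.2⟫
  have hφ : ∀ t, HasDerivAt φ (⟪(proxInvDeriv η L (q + t • d) d).1, d.1⟫ +
      ⟪(proxInvDeriv η L (q + t • d) d).2, d.2⟫) t := by
    intro t
    have hline : HasDerivAt (fun t : ℝ => q + t • d) d t := by
      simpa using ((hasDerivAt_id t).smul_const d).const_add q
    have h := (hasFDerivAt_proxInv hL η (q + t • d)).comp_hasDerivAt t hline
    have h1 := (hasFDerivAt_fst.comp_hasDerivAt t h).inner ℝ (hasDerivAt_const t d.1)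
    have h2 := (hasFDerivAt_snd.comp_hasDerivAt t h).inner ℝ (hasDerivAt_const t d.2)
    refine (h1.add h2).congr_deriv ?_
    simp
  obtain ⟨t, -, ht⟩ := exists_hasDerivAt_eq_slope φ _ one_pos
    (fun t _ => (hφ t).continuousAt.continuousWithinAt) (fun t _ => hφ t)
  have hval : φ 1 - φ 0 = ⟪(proxInv η L p - proxInv η L q).1, d.1⟫ +
      ⟪(proxInv η L p - proxInv η L q).2, d.2⟫ := by
    simp only [φ, one_smul, zero_smul, add_zero, hd, add_sub_cancel, Prod.fst_sub, Prod.snd_sub,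
      inner_sub_left]
    ring
  rw [← hval]
  have := proxInvDeriv_coercive hL hη hweak (q + t • d) d
  rw [ht] at this
  simpa using this

lemma hasFDerivAt_half_norm_sub_sq {E : Type*} [NormedAddCommGroup E] [InnerProductSpace ℝ E]
    (η : ℝ) (x w : E) :
    HasFDerivAt (fun u => η / 2 * ‖u - x‖ ^ 2) (η • innerSL ℝ (w - x)) w := by
  have h := (((hasFDerivAt_id w).sub_const x).norm_sq).const_mul (η / 2)
  refine h.congr_fderiv (ContinuousLinearMap.ext fun u => ?_)
  simp
  ring

lemma IsProxPoint.gradx_eq (hL : Differentiable ℝ L) {η : ℝ} {z w : Eu n × Eu m}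
    (h : IsProxPoint η L z w) : gradx L w = -(η • (w.1 - z.1)) := by
  have hd : HasFDerivAt (fun u => proxObj η L z (u, w.2)) _ w.1 :=
    ((HasFDerivAt.comp (g := L) w.1 (hL w).hasFDerivAt
      (hasFDerivAt_prodMk_left w.1 w.2)).add (hasFDerivAt_half_norm_sub_sq η z.1 w.1)).sub_const
      (η / 2 * ‖w.2 - z.2‖ ^ 2)
  have hmin : IsLocalMin (fun u => proxObj η L z (u, w.2)) w.1 :=
    Eventually.of_forall fun u => h.2 u
  have h0 := hmin.hasFDerivAt_eq_zero hd
  refine ext_inner_right ℝ fun a => ?_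
  have h1 := congrArg (fun T => T a) h0
  rw [inner_gradx (hL w), inner_neg_left, real_inner_smul_left]
  simp [inner_sub_left] at h1 ⊢
  linarith

lemma IsProxPoint.grady_eq (hL : Differentiable ℝ L) {η : ℝ} {z w : Eu n × Eu m}
    (h : IsProxPoint η L z w) : grady L w = η • (w.2 - z.2) := by
  have hd : HasFDerivAt (fun v => proxObj η L z (w.1, v)) _ w.2 :=
    ((HasFDerivAt.comp (g := L) w.2 (hL w).hasFDerivAt
      (hasFDerivAt_prodMk_right w.1 w.2)).add_const (η / 2 * ‖w.1 - z.1‖ ^ 2)).sub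
      (hasFDerivAt_half_norm_sub_sq η z.2 w.2)
  have hmax : IsLocalMax (fun v => proxObj η L z (w.1, v)) w.2 :=
    Eventually.of_forall fun v => h.1 v
  have h0 := hmax.hasFDerivAt_eq_zero hd
  refine ext_inner_right ℝ fun b => ?_
  have h1 := congrArg (fun T => T b) h0
  rw [inner_grady (hL w), real_inner_smul_left]
  simp [inner_sub_left] at h1 ⊢
  linarith

lemma IsProxPoint.proxInv_eq (hL : Differentiable ℝ L) {η : ℝ} (hη : 0 < η)
    {z w : Eu n × Eu m} (h : IsProxPoint η L z w) : proxInv η L w = z := by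
  rw [proxInv, h.gradx_eq hL, h.grady_eq hL, smul_neg, inv_smul_smul₀ hη.ne',
    inv_smul_smul₀ hη.ne']
  ext <;> simp

variable {ρ η : ℝ} {prox : Eu n × Eu m → Eu n × Eu m}

lemma continuous_prox (hL : ContDiff ℝ 2 L) (hη : 0 < η) (hρ : ρ < η)
    (hweak : WeaklyConvexConcave ρ L) (hprox : ∀ z, IsProxPoint η L z (prox z)) :
    Continuous prox := by
  have hd : Differentiable ℝ L := hL.differentiable (by norm_num)
  have hc : 0 < 1 - ρ / η := by rw [sub_pos, div_lt_one hη]; exact hρ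
  set c := 1 - ρ / η
  have hlip : LipschitzWith (Real.toNNReal (2 / c)) prox := by
    refine LipschitzWith.of_dist_le_mul fun z z' => ?_
    rw [Real.coe_toNNReal _ (by positivity), dist_eq_norm, dist_eq_norm]
    have hmon := proxInv_strongly_monotone hL hη hweak (prox z) (prox z')
    rw [(hprox z).proxInv_eq hd hη, (hprox z').proxInv_eq hd hη] at hmon
    set d := prox z - prox z'
    have b1 : ⟪(z - z').1, d.1⟫ ≤ ‖z - z'‖ * ‖d‖ :=
      (real_inner_le_norm _ _).trans (mul_le_mul (norm_fst_le _) (norm_fst_le _)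
        (norm_nonneg _) (norm_nonneg _))
    have b2 : ⟪(z - z').2, d.2⟫ ≤ ‖z - z'‖ * ‖d‖ :=
      (real_inner_le_norm _ _).trans (mul_le_mul (norm_snd_le _) (norm_snd_le _)
        (norm_nonneg _) (norm_nonneg _))
    have b3 : ‖d‖ ^ 2 ≤ ‖d.1‖ ^ 2 + ‖d.2‖ ^ 2 := by
      rcases max_cases ‖d.1‖ ‖d.2‖ with h | h <;> rw [Prod.norm_def, h.1] <;>
        nlinarith [sq_nonneg ‖d.1‖, sq_nonneg ‖d.2‖]
    have b4 := mul_le_mul_of_nonneg_left b3 hc.le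
    rcases (norm_nonneg d).eq_or_lt with h0 | h0
    · rw [← h0]; positivity
    · rw [div_mul_eq_mul_div, le_div_iff₀ hc]
      refine le_of_mul_le_mul_right ?_ h0
      linarith
  exact hlip.continuous

lemma exists_hasFDerivAt_prox (hL : ContDiff ℝ 2 L) (hη : 0 < η) (hρ : ρ < η)
    (hweak : WeaklyConvexConcave ρ L) (hprox : ∀ z, IsProxPoint η L z (prox z))
    (z : Eu n × Eu m) :
    ∃ P : Eu n × Eu m →L[ℝ] Eu n × Eu m, HasFDerivAt prox P z ∧
      ∀ v, proxInvDeriv η L (prox z) (P v) = v := by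
  have hd : Differentiable ℝ L := hL.differentiable (by norm_num)
  have hc : 0 < 1 - ρ / η := by rw [sub_pos, div_lt_one hη]; exact hρ
  have hinj : Function.Injective (proxInvDeriv η L (prox z)) := by
    refine (injective_iff_map_eq_zero _).2 fun d h0 => ?_
    have h := proxInvDeriv_coercive hL hη hweak (prox z) d
    rw [h0] at h
    simp only [Prod.fst_zero, Prod.snd_zero, inner_zero_left, add_zero] at h
    have h' : ‖d.1‖ ^ 2 + ‖d.2‖ ^ 2 ≤ 0 := by
      by_contra! hlt
      exact absurd h (not_le.2 (mul_pos hc hlt))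
    have h1 : ‖d.1‖ = 0 := pow_eq_zero_iff two_ne_zero |>.1
      (le_antisymm (by linarith [sq_nonneg ‖d.2‖]) (sq_nonneg _))
    have h2 : ‖d.2‖ = 0 := pow_eq_zero_iff two_ne_zero |>.1
      (le_antisymm (by linarith [sq_nonneg ‖d.1‖]) (sq_nonneg _))
    exact Prod.ext (norm_eq_zero.1 h1) (norm_eq_zero.1 h2)
  let e : (Eu n × Eu m) ≃L[ℝ] (Eu n × Eu m) := (LinearEquiv.ofInjectiveEndo
    (proxInvDeriv η L (prox z) : Eu n × Eu m →ₗ[ℝ] Eu n × Eu m) hinj).toContinuousLinearEquiv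
  have he : ∀ v, e v = proxInvDeriv η L (prox z) v := fun _ => rfl
  have hder : HasFDerivAt (proxInv η L) (e : Eu n × Eu m →L[ℝ] Eu n × Eu m) (prox z) :=
    hasFDerivAt_proxInv hL η (prox z)
  refine ⟨e.symm, hder.of_local_left_inverse
    (continuous_prox hL hη hρ hweak hprox).continuousAt
    (Eventually.of_forall fun y => (hprox y).proxInv_eq hd hη), fun v => ?_⟩
  rw [← he]
  exact e.apply_symm_apply v

lemma hasFDerivAt_saddleEnv (hL : Differentiable ℝ L)
    (hprox : ∀ z, IsProxPoint η L z (prox z)) {z : Eu n × Eu m}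
    {P : Eu n × Eu m →L[ℝ] Eu n × Eu m} (hP : HasFDerivAt prox P z) :
    HasFDerivAt (saddleEnv η L prox)
      ((innerSL ℝ (η • (z.1 - (prox z).1))).coprod (innerSL ℝ (η • ((prox z).2 - z.2)))) z := by
  have h := (((hL (prox z)).hasFDerivAt.comp z hP).add
    (((hP.fst.sub hasFDerivAt_fst).norm_sq).const_mul (η / 2))).sub
    (((hP.snd.sub hasFDerivAt_snd).norm_sq).const_mul (η / 2))
  refine HasFDerivAt.congr_fderiv h ?_
  refine ContinuousLinearMap.ext fun v => ?_
  have hLv := fderiv_apply_eq_inner (hL (prox z)) (P v)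
  rw [(hprox z).gradx_eq hL, (hprox z).grady_eq hL] at hLv
  simp [hLv, inner_sub_left, real_inner_smul_left]
  ring

lemma gradient_saddleEnv_fst (hL : Differentiable ℝ L)
    (hprox : ∀ z, IsProxPoint η L z (prox z)) (hd : Differentiable ℝ prox) (z : Eu n × Eu m) :
    gradient (fun u => saddleEnv η L prox (u, z.2)) z.1 = η • (z.1 - (prox z).1) := by
  have hS := hasFDerivAt_saddleEnv hL hprox (hd z).hasFDerivAt
  refine ext_inner_right ℝ fun a => ?_
  refine (inner_gradx hS.differentiableAt a).trans ?_
  rw [hS.fderiv]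
  simp [inner_sub_left, real_inner_smul_left]

lemma gradient_saddleEnv_snd (hL : Differentiable ℝ L)
    (hprox : ∀ z, IsProxPoint η L z (prox z)) (hd : Differentiable ℝ prox) (z : Eu n × Eu m) :
    gradient (fun v => saddleEnv η L prox (z.1, v)) z.2 = η • ((prox z).2 - z.2) := by
  have hS := hasFDerivAt_saddleEnv hL hprox (hd z).hasFDerivAt
  refine ext_inner_right ℝ fun b => ?_
  refine (inner_grady hS.differentiableAt b).trans ?_
  rw [hS.fderiv]
  simp [inner_sub_left, real_inner_smul_left]

lemma proxInvDeriv_apply_eq (hη : 0 < η) {w d v : Eu n × Eu m}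
    (h : proxInvDeriv η L w d = v) :
    η • d.1 + (Hxx L w d.1 + Hxy L w d.2) = η • v.1 ∧
      η • d.2 - (Hyx L w d.1 + Hyy L w d.2) = η • v.2 := by
  subst h
  simp [proxInvDeriv, smul_add, smul_sub, smul_inv_smul₀ hη.ne']

end Partial

/-- under α-interaction dominance, the Hessian of the saddle
envelope in x (resp. −Hessian in y) is bounded between (ηα/(η+α))I and ηI. -/
theorem statement7 {n m : ℕ}
    (L : Eu n × Eu m → ℝ) (ρ η α : ℝ)
    (hL : ContDiff ℝ 2 L)
    (hweak : WeaklyConvexConcave ρ L)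
    (hη : max ρ 0 < η)
    (hηα : 0 < η + α)
    (prox : Eu n × Eu m → Eu n × Eu m)
    (hprox : ∀ z, IsProxPoint η L z (prox z))
    (hprox_uniq : ∀ z w, IsProxPoint η L z w → w = prox z) :
    (IntDomX η α L →
      ∀ z : Eu n × Eu m, ∃ H : Eu n →L[ℝ] Eu n,
        HasFDerivAt (fun x => gradient (fun u => saddleEnv η L prox (u, z.2)) x) H z.1 ∧
        ∀ v : Eu n,
          η * α / (η + α) * ‖v‖ ^ 2 ≤ ⟪H v, v⟫ ∧ ⟪H v, v⟫ ≤ η * ‖v‖ ^ 2) ∧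
    (IntDomY η α L →
      ∀ z : Eu n × Eu m, ∃ H : Eu m →L[ℝ] Eu m,
        HasFDerivAt (fun y => gradient (fun v => saddleEnv η L prox (z.1, v)) y) H z.2 ∧
        ∀ w : Eu m,
          η * α / (η + α) * ‖w‖ ^ 2 ≤ ⟪-(H w), w⟫ ∧ ⟪-(H w), w⟫ ≤ η * ‖w‖ ^ 2) := by
  have hη0 : 0 < η := (le_max_right ρ 0).trans_lt hη
  have hρ : ρ < η := (le_max_left ρ 0).trans_lt hη
  have hd : Differentiable ℝ L := hL.differentiable (by norm_num)
  have hder := exists_hasFDerivAt_prox hL hη0 hρ hweak hprox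
  have hdp : Differentiable ℝ prox := fun z =>
    let ⟨_, hP, _⟩ := hder z
    hP.differentiableAt
  refine ⟨fun hdom z => ?_, fun hdom z => ?_⟩
  · obtain ⟨P, hP, hPinv⟩ := hder z
    have hgrad : (fun x => gradient (fun u => saddleEnv η L prox (u, z.2)) x) =
        fun x => η • (x - (prox (x, z.2)).1) :=
      funext fun x => gradient_saddleEnv_fst hd hprox hdp (x, z.2)
    have hpx := (HasFDerivAt.comp (g := prox) (f := fun x => (x, z.2)) z.1 hP (hasFDerivAt_prodMk_left z.1 z.2)).fst
    rw [hgrad]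
    refine ⟨_, ((hasFDerivAt_id z.1).sub hpx).const_smul η, fun v => ?_⟩
    obtain ⟨h1, h2⟩ := proxInvDeriv_apply_eq hη0 (hPinv (v, 0))
    have hb := eq_ringInverse_apply_of_coercive (sub_pos.2 hρ)
      (A := η • (1 : Eu m →L[ℝ] Eu m) - Hyy L (prox z)) (b := (P (v, 0)).2)
      (y := Hyx L (prox z) (P (v, 0)).1)
      (fun w => by
        have := (hweak (prox z)).2 w
        simp only [sub_apply, smul_apply,
          one_apply_eq_self, inner_sub_left, real_inner_smul_left,
          real_inner_self_eq_norm_sq]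
        linarith)
      (by
        simp only [sub_apply, smul_apply,
          one_apply_eq_self]
        rw [smul_zero, sub_eq_zero] at h2
        rw [h2, add_sub_cancel_right])
    have hq := hdom (prox z) (P (v, 0)).1
    rw [← hb] at hq
    exact hessian_bounds_of_resolvent hη0 hηα h1 hq
  · obtain ⟨P, hP, hPinv⟩ := hder z
    have hgrad : (fun y => gradient (fun v => saddleEnv η L prox (z.1, v)) y) =
        fun y => η • ((prox (z.1, y)).2 - y) :=
      funext fun y => gradient_saddleEnv_snd hd hprox hdp (z.1, y)
    have hpy := (HasFDerivAt.comp (g := prox) (f := fun y => (z.1, y)) z.2 hP (hasFDerivAt_prodMk_right z.1 z.2)).snd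
    rw [hgrad]
    refine ⟨_, (hpy.sub (hasFDerivAt_id z.2)).const_smul η, fun w => ?_⟩
    obtain ⟨h1, h2⟩ := proxInvDeriv_apply_eq hη0 (hPinv (0, w))
    have ha := eq_ringInverse_apply_of_coercive (sub_pos.2 hρ)
      (A := η • (1 : Eu n →L[ℝ] Eu n) + Hxx L (prox z)) (b := -(P (0, w)).1)
      (y := Hxy L (prox z) (P (0, w)).2)
      (fun v => by
        have := (hweak (prox z)).1 v
        simp only [add_apply, smul_apply,
          one_apply_eq_self, inner_add_left, real_inner_smul_left,
          real_inner_self_eq_norm_sq]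
        linarith)
      (by
        simp only [add_apply, smul_apply,
          one_apply_eq_self, map_neg]
        rw [smul_zero, ← add_assoc, add_eq_zero_iff_eq_neg] at h1
        rw [h1, neg_neg])
    have hq := hdom (prox z) (P (0, w)).2
    rw [← ha, map_neg] at hq
    have hres : η • (P (0, w)).2 + (-(Hyy L (prox z) (P (0, w)).2) +
        -(Hyx L (prox z) (P (0, w)).1)) = η • w := by
      rw [← h2]
      abel
    have hbounds := hessian_bounds_of_resolvent hη0 hηα hres hq
    rw [← neg_sub, smul_neg] at hbounds
    exact hbounds

end
end
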